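/- Let p : ℝ^d → ℝ be a continuously differentiable probability density with p(x) > 0 for all x, such that p and each component of ∇p are bounded and continuous. Then for every x ∈ ℝ^d, lim_{γ→0} ∇_x log(p*g_γ)(x) = ∇ log p(x). -/

import Mathlib

open MeasureTheory Filter Real Topology

/-- The density of the Gaussian `N(0, γ I)` on `ℝ^d`. -/
noncomputable def gaussDensity (d : ℕ) (γ : ℝ) (x : EuclideanSpace ℝ (Fin d)) : ℝ :=
  (2 * π * γ) ^ (-(d : ℝ) / 2) * Real.exp (-‖x‖ ^ 2 / (2 * γ))

/-- Convolution `(p * g_γ)(x) = ∫ p(y) g_γ(x - y) dy` of a density with the Gaussian. -/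
noncomputable def gaussConv (d : ℕ) (p : EuclideanSpace ℝ (Fin d) → ℝ) (γ : ℝ)
    (x : EuclideanSpace ℝ (Fin d)) : ℝ :=
  ∫ y, p y * gaussDensity d γ (x - y)

lemma continuous_gaussDensity (d : ℕ) (γ : ℝ) : Continuous (gaussDensity d γ) := by
  unfold gaussDensity
  fun_prop

lemma gaussDensity_nonneg (d : ℕ) {γ : ℝ} (hγ : 0 ≤ γ) (x : EuclideanSpace ℝ (Fin d)) :
    0 ≤ gaussDensity d γ x := by
  unfold gaussDensity
  positivity

lemma integral_gaussDensity_one (d : ℕ) : ∫ u, gaussDensity d 1 u = 1 := by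
  have h := GaussianFourier.integral_rexp_neg_mul_sq_norm (V := EuclideanSpace ℝ (Fin d))
    (b := 1 / 2) (by norm_num)
  have h2 : ∀ u : EuclideanSpace ℝ (Fin d),
      gaussDensity d 1 u = (2 * π) ^ (-(d : ℝ) / 2) * rexp (-(1 / 2) * ‖u‖ ^ 2) := by
    intro u
    simp only [gaussDensity, mul_one]
    congr 2
    ring
  simp_rw [h2]
  rw [integral_const_mul, h, finrank_euclideanSpace_fin,
    show π / (1 / 2) = 2 * π by ring, ← rpow_add (by positivity)]
  simp [neg_div]

lemma integrable_gaussDensity_one (d : ℕ) : Integrable (gaussDensity d 1) := by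
  by_contra h
  simpa [integral_undef h] using integral_gaussDensity_one d

lemma pow_mul_gaussDensity_smul (d : ℕ) {s : ℝ} (hs : 0 < s) (u : EuclideanSpace ℝ (Fin d)) :
    s ^ d * gaussDensity d (s ^ 2) (s • u) = gaussDensity d 1 u := by
  have h1 : (2 * π * s ^ 2) ^ (-(d : ℝ) / 2) = (2 * π) ^ (-(d : ℝ) / 2) * (s ^ d)⁻¹ := by
    rw [mul_rpow (by positivity) (by positivity), ← rpow_natCast s 2, ← rpow_mul hs.le,
      show ((2 : ℕ) : ℝ) * (-(d : ℝ) / 2) = -(d : ℝ) by push_cast; ring, rpow_neg hs.le,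
      rpow_natCast]
  have h2 : -‖s • u‖ ^ 2 / (2 * s ^ 2) = -‖u‖ ^ 2 / (2 * 1) := by
    rw [norm_smul, norm_eq_abs, abs_of_pos hs]
    field_simp
  simp only [gaussDensity, h1, h2, mul_one]
  field_simp

lemma gaussConv_sq (d : ℕ) (p : EuclideanSpace ℝ (Fin d) → ℝ) {s : ℝ} (hs : 0 < s)
    (x : EuclideanSpace ℝ (Fin d)) :
    gaussConv d p (s ^ 2) x = ∫ u, gaussDensity d 1 u • p (x - s • u) := by
  have h1 : gaussConv d p (s ^ 2) x = ∫ y, p (x - y) * gaussDensity d (s ^ 2) y := by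
    rw [gaussConv, ← integral_sub_left_eq_self _ volume x]
    simp
  have h2 := Measure.integral_comp_smul volume
    (fun y => p (x - y) * gaussDensity d (s ^ 2) y) s
  rw [finrank_euclideanSpace_fin, abs_of_pos (by positivity), ← h1, smul_eq_mul] at h2
  simp_rw [← pow_mul_gaussDensity_smul d hs, smul_eq_mul, mul_assoc, integral_const_mul]
  simp_rw [mul_comm (gaussDensity d (s ^ 2) _), h2]
  field_simp

lemma tendsto_integral_gaussDensity_smul {F : Type*} [NormedAddCommGroup F] [NormedSpace ℝ F]
    [CompleteSpace F] (d : ℕ) {f : EuclideanSpace ℝ (Fin d) → F} (hf : Continuous f) {C : ℝ}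
    (hC : ∀ x, ‖f x‖ ≤ C) (x : EuclideanSpace ℝ (Fin d)) :
    Tendsto (fun s : ℝ => ∫ u, gaussDensity d 1 u • f (x - s • u)) (𝓝 0) (𝓝 (f x)) := by
  have hφ := continuous_gaussDensity d 1
  have h : Tendsto (fun s : ℝ => ∫ u, gaussDensity d 1 u • f (x - s • u)) (𝓝 0)
      (𝓝 (∫ u, gaussDensity d 1 u • f x)) := by
    refine tendsto_integral_filter_of_dominated_convergence (fun u => gaussDensity d 1 u * C)
      (.of_forall fun s => ?_) (.of_forall fun s => .of_forall fun u => ?_)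
      ((integrable_gaussDensity_one d).mul_const C) (.of_forall fun u => ?_)
    · exact (by fun_prop : Continuous _).aestronglyMeasurable
    · have h0 := gaussDensity_nonneg d zero_le_one u
      rw [norm_smul, norm_eq_abs, abs_of_nonneg h0]
      gcongr
      exact hC _
    · have hc : Continuous fun s : ℝ => gaussDensity d 1 u • f (x - s • u) := by fun_prop
      simpa using hc.tendsto 0
  rwa [integral_smul_const, integral_gaussDensity_one, one_smul] at h

lemma hasFDerivAt_integral_gaussDensity_smul (d : ℕ) {p : EuclideanSpace ℝ (Fin d) → ℝ}
    (hp : ContDiff ℝ 1 p) {B C : ℝ} (hB : ∀ x, ‖p x‖ ≤ B) (hC : ∀ x, ‖fderiv ℝ p x‖ ≤ C) (s : ℝ)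
    (x : EuclideanSpace ℝ (Fin d)) :
    HasFDerivAt (fun x => ∫ u, gaussDensity d 1 u • p (x - s • u))
      (∫ u, gaussDensity d 1 u • fderiv ℝ p (x - s • u)) x := by
  have hφ := continuous_gaussDensity d 1
  have hpc := hp.continuous
  have hpd : Continuous (fderiv ℝ p) := hp.continuous_fderiv one_ne_zero
  refine hasFDerivAt_integral_of_dominated_of_fderiv_le (s := Set.univ)
    (F' := fun x u => gaussDensity d 1 u • fderiv ℝ p (x - s • u))
    (bound := fun u => gaussDensity d 1 u * C) univ_mem (.of_forall fun y => ?_) ?_ ?_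
    (.of_forall fun u y _ => ?_) ((integrable_gaussDensity_one d).mul_const C)
    (.of_forall fun u y _ => ?_)
  · exact (by fun_prop : Continuous _).aestronglyMeasurable
  · refine (integrable_gaussDensity_one d).mul_bdd (c := B) ?_ (.of_forall fun u => hB _)
    exact (by fun_prop : Continuous _).aestronglyMeasurable
  · exact (by fun_prop : Continuous _).aestronglyMeasurable
  · have h0 := gaussDensity_nonneg d zero_le_one u
    rw [norm_smul, norm_eq_abs, abs_of_nonneg h0]
    gcongr
    exact hC _
  · have h := (hp.differentiable one_ne_zero (y - s • u)).hasFDerivAt.comp y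
      ((hasFDerivAt_id y).sub_const (s • u))
    exact h.const_smul (gaussDensity d 1 u)

/-- For a continuously differentiable, everywhere positive probability density `p` with `p` and
`∇p` bounded (and continuous), the score of the smoothed density converges pointwise to the
score of `p`: `lim_{γ→0⁺} ∇ₓ log(p*g_γ)(x) = ∇ log p(x)`. -/
theorem score_of_smoothed_tendsto_score (d : ℕ) (p : EuclideanSpace ℝ (Fin d) → ℝ)
    (hsmooth : ContDiff ℝ 1 p) (hpos : ∀ x, 0 < p x) (hprob : ∫ x, p x = 1)
    (hpcont : Continuous p) (hpbdd : ∃ C, ∀ x, |p x| ≤ C)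
    (hgradcont : Continuous (gradient p)) (hgradbdd : ∃ C, ∀ x, ‖gradient p x‖ ≤ C)
    (x : EuclideanSpace ℝ (Fin d)) :
    Tendsto (fun γ : ℝ => gradient (fun y => Real.log (gaussConv d p γ y)) x)
      (𝓝[>] (0 : ℝ)) (𝓝 (gradient (fun y => Real.log (p y)) x)) := by
  obtain ⟨B, hB⟩ := hpbdd
  obtain ⟨C, hC⟩ := hgradbdd
  have hC' : ∀ x, ‖fderiv ℝ p x‖ ≤ C := fun x => by simpa [gradient] using hC x
  refine ((InnerProductSpace.toDual ℝ _).symm.continuous.tendsto _).comp ?_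
  have hsqrt : Tendsto (fun γ : ℝ => √γ) (𝓝[>] 0) (𝓝 0) := by
    simpa using (continuous_sqrt.tendsto 0).mono_left nhdsWithin_le_nhds
  have hval := (tendsto_integral_gaussDensity_smul d hpcont hB x).comp hsqrt
  have hder := (tendsto_integral_gaussDensity_smul d
    (hsmooth.continuous_fderiv one_ne_zero) hC' x).comp hsqrt
  rw [((hsmooth.differentiable one_ne_zero x).hasFDerivAt.log (hpos x).ne').fderiv]
  refine ((hval.inv₀ (hpos x).ne').smul hder).congr' ?_
  filter_upwards [self_mem_nhdsWithin, hval.eventually_ne (hpos x).ne'] with γ hγ hne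
  have hconv : gaussConv d p γ = fun y => ∫ u, gaussDensity d 1 u • p (y - √γ • u) := by
    funext y
    rw [← gaussConv_sq d p (sqrt_pos.2 hγ), sq_sqrt (le_of_lt hγ)]
  rw [hconv]
  exact ((hasFDerivAt_integral_gaussDensity_smul d hsmooth hB hC' (√γ) x).log hne).fderiv.symm
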